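/- Fix r > 1/2 and define y(s,r) = 4r·(Γ((s+2r+1)/(4r))·Γ((s+4r−1)/(4r)))/(Γ((s+1)/(4r))·Γ((s+2r−1)/(4r))) for s > 0. Then for every s > max(1, 2r−1), ∂²/∂s² (ln y)(s,r) = −(1/(2r²))·∫_0^∞ x·(e^{−((1−r+s)/r)·x} + e^{−((r−1+s)/r)·x})/cosh x dx = −h₁(s,r) − h₂(s,r), where h₁(s,r) = 1/( 2(1−2r+s)(1+s) + 2·TK_{n=1}^∞ (4n²r²/1 + 4n²r²/((1−2r+s)(1+s))) ) and h₂(s,r) = 1/( 2(2r−1+s)(s−1) + 2·TK_{n=1}^∞ (4n²r²/1 + 4n²r²/((2r−1+s)(s−1))) ). -/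

import Mathlib

open Filter Real

/-- Numerators of the convergents of a generalized continued fraction with
integer part `b₀`, partial numerators `a n` and partial denominators `b n` (for `n ≥ 1`). -/
noncomputable def cfNum (b₀ : ℝ) (a b : ℕ → ℝ) : ℕ → ℝ
  | 0 => b₀
  | 1 => b 1 * b₀ + a 1
  | n + 2 => b (n + 2) * cfNum b₀ a b (n + 1) + a (n + 2) * cfNum b₀ a b n

/-- Denominators of the convergents of a generalized continued fraction. -/
noncomputable def cfDen (a b : ℕ → ℝ) : ℕ → ℝ
  | 0 => 1
  | 1 => b 1
  | n + 2 => b (n + 2) * cfDen a b (n + 1) + a (n + 2) * cfDen a b n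

/-- `IsCFLimit b₀ a b L` means: the convergents of the generalized continued fraction
`b₀ + a 1 / (b 1 + a 2 / (b 2 + ⋯))` tend to `L`. -/
def IsCFLimit (b₀ : ℝ) (a b : ℕ → ℝ) (L : ℝ) : Prop :=
  Filter.Tendsto (fun n => cfNum b₀ a b n / cfDen a b n) Filter.atTop (nhds L)

/-- The generalized Brouncker function `y(s, r)` expressed through the Gamma function. -/
noncomputable def yGen (r s : ℝ) : ℝ :=
  4 * r * (Real.Gamma ((s + 2*r + 1) / (4*r)) * Real.Gamma ((s + 4*r - 1) / (4*r))) /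
    (Real.Gamma ((s + 1) / (4*r)) * Real.Gamma ((s + 2*r - 1) / (4*r)))


/-- Normalised convergent components: shear recursion. -/
noncomputable def shr (r u m0 p0 : ℝ) : ℕ → ℝ × ℝ
  | 0 => (m0, p0)
  | k + 1 =>
    let m := (shr r u m0 p0 k).1 + (shr r u m0 p0 k).2 * (4 * ((k : ℝ) + 1) ^ 2 * r ^ 2)⁻¹
    (m, (shr r u m0 p0 k).2 + u * m)

lemma shr_succ_fst (r u m0 p0 : ℝ) (k : ℕ) : (shr r u m0 p0 (k+1)).1 =
    (shr r u m0 p0 k).1 + (shr r u m0 p0 k).2 * (4 * ((k : ℝ) + 1) ^ 2 * r ^ 2)⁻¹ := rfl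

lemma shr_succ_snd (r u m0 p0 : ℝ) (k : ℕ) : (shr r u m0 p0 (k+1)).2 =
    (shr r u m0 p0 k).2 + u * (shr r u m0 p0 (k+1)).1 := rfl

lemma shr_det (r u : ℝ) (k : ℕ) :
    (shr r u 1 u k).1 * (shr r u 0 1 k).2 - (shr r u 1 u k).2 * (shr r u 0 1 k).1 = 1 := by
  induction k with
  | zero => simp [shr]
  | succ k ih =>
    simp only [shr_succ_snd, shr_succ_fst]
    linear_combination ih

lemma shr_form (r v u u' : ℝ) (hr : 0 < r) (hu : u = v ^ 2 - 2 * v * r) (hu' : u' = v ^ 2 + 2 * v * r)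
    (k : ℕ) :
    (2 * ((shr r u 1 u k).1 * (shr r u' 1 u' k).1) - v ^ 2 * ((shr r u 1 u k).1 * (shr r u' 0 1 k).1
      + (shr r u 0 1 k).1 * (shr r u' 1 u' k).1) = 2) ∧
    (2 * ((shr r u 1 u k).1 * ((shr r u' 1 u' k).2 - u' * (shr r u' 1 u' k).1))
      - v ^ 2 * ((shr r u 1 u k).1 * ((shr r u' 0 1 k).2 - u' * (shr r u' 0 1 k).1)
      + (shr r u 0 1 k).1 * ((shr r u' 1 u' k).2 - u' * (shr r u' 1 u' k).1))
      = - (v ^ 2 - 4 * k * v * r)) ∧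
    (2 * (((shr r u 1 u k).2 - u * (shr r u 1 u k).1) * (shr r u' 1 u' k).1)
      - v ^ 2 * (((shr r u 1 u k).2 - u * (shr r u 1 u k).1) * (shr r u' 0 1 k).1
      + ((shr r u 0 1 k).2 - u * (shr r u 0 1 k).1) * (shr r u' 1 u' k).1)
      = - (v ^ 2 + 4 * k * v * r)) ∧
    (2 * (((shr r u 1 u k).2 - u * (shr r u 1 u k).1) *
        ((shr r u' 1 u' k).2 - u' * (shr r u' 1 u' k).1))
      - v ^ 2 * (((shr r u 1 u k).2 - u * (shr r u 1 u k).1) *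
        ((shr r u' 0 1 k).2 - u' * (shr r u' 0 1 k).1)
      + ((shr r u 0 1 k).2 - u * (shr r u 0 1 k).1) *
        ((shr r u' 1 u' k).2 - u' * (shr r u' 1 u' k).1))
      = - (8 * k ^ 2 * v ^ 2 * r ^ 2)) := by
  induction k with
  | zero => simp [shr]
  | succ k ih =>
    obtain ⟨h1, h2, h3, h4⟩ := ih
    have hi : (4 * ((k : ℝ) + 1) ^ 2 * r ^ 2)⁻¹ * (4 * ((k : ℝ) + 1) ^ 2 * r ^ 2) = 1 :=
      inv_mul_cancel₀ (by positivity)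
    simp only [shr_succ_snd, shr_succ_fst]
    generalize (4 * ((k : ℝ) + 1) ^ 2 * r ^ 2)⁻¹ = i at *
    generalize (shr r u 1 u k).1 = m at *
    generalize (shr r u 1 u k).2 = p at *
    generalize (shr r u 0 1 k).1 = o at *
    generalize (shr r u 0 1 k).2 = q at *
    generalize (shr r u' 1 u' k).1 = m' at *
    generalize (shr r u' 1 u' k).2 = p' at *
    generalize (shr r u' 0 1 k).1 = o' at *
    generalize (shr r u' 0 1 k).2 = q' at *
    push_cast
    refine ⟨?_, ?_, ?_, ?_⟩
    · have e : 2*(1+i*u)*(1+i*u') - (1+i*u)*i*(v^2-4*k*v*r) - i*(1+i*u')*(v^2+4*k*v*r)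
        - i^2*(8*k^2*v^2*r^2) = 2 := by
        subst hu hu'
        linear_combination (-2*v^2*i) * hi
      linear_combination e + (1+i*u)*(1+i*u')*h1 + (1+i*u)*i*h2 + i*(1+i*u')*h3 + i^2*h4
    · have e : -(1+i*u)*(v^2-4*k*v*r) + 2*(1+i*u)*u' - i*(8*k^2*v^2*r^2) - i*u'*(v^2+4*k*v*r)
        = -(v^2-4*(k+1)*v*r) := by
        subst hu hu'
        linear_combination (-2*v^2) * hi
      linear_combination e + (1+i*u)*h2 + (1+i*u)*u'*h1 + i*h4 + i*u'*h3
    · have e : -(1+i*u')*(v^2+4*k*v*r) + 2*(1+i*u')*u - i*(8*k^2*v^2*r^2) - i*u*(v^2-4*k*v*r)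
        = -(v^2+4*(k+1)*v*r) := by
        subst hu hu'
        linear_combination (-2*v^2) * hi
      linear_combination e + (1+i*u')*h3 + (1+i*u')*u*h1 + i*h4 + i*u*h2
    · have e : 2*u*u' - u*(v^2-4*k*v*r) - u'*(v^2+4*k*v*r) - 8*k^2*v^2*r^2
        = -(8*(k+1)^2*v^2*r^2) := by
        subst hu hu'
        ring
      linear_combination e + u*u'*h1 + u*h2 + u'*h3 + h4

lemma shr_pos (r u m0 p0 : ℝ) (hr : 0 < r) (hu : 0 < u) (hm : 0 ≤ m0) (hp : 0 < p0) (k : ℕ) :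
    0 ≤ (shr r u m0 p0 k).1 ∧ 0 < (shr r u m0 p0 k).2 := by
  induction k with
  | zero => exact ⟨hm, hp⟩
  | succ k ih =>
    obtain ⟨h1, h2⟩ := ih
    have h : 0 ≤ (shr r u m0 p0 (k+1)).1 := by rw [shr_succ_fst]; positivity
    refine ⟨h, ?_⟩
    rw [shr_succ_snd]; positivity

lemma shr_o_ge (r u : ℝ) (hr : 0 < r) (hu : 0 < u) (k : ℕ) :
    (4 * r ^ 2)⁻¹ ≤ (shr r u 0 1 (k+1)).1 := by
  induction k with
  | zero => simp [shr]
  | succ k ih =>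
    rw [shr_succ_fst]
    have := (shr_pos r u 0 1 hr hu le_rfl one_pos (k+1)).2
    have : 0 ≤ (shr r u 0 1 (k+1)).2 * (4 * (((k+1 : ℕ) : ℝ) + 1) ^ 2 * r ^ 2)⁻¹ := by positivity
    linarith

lemma shr_q_ge (r u : ℝ) (hr : 0 < r) (hu : 0 < u) (k : ℕ) :
    k * (u * (4 * r ^ 2)⁻¹) ≤ (shr r u 0 1 k).2 := by
  induction k with
  | zero => simp [shr]
  | succ k ih =>
    rw [shr_succ_snd]
    have := mul_le_mul_of_nonneg_left (shr_o_ge r u hr hu k) hu.le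
    push_cast
    linarith

lemma shr_lim (r u : ℝ) (hr : 0 < r) (hu : 0 < u) : ∃ X : ℝ, u ≤ X ∧
    Tendsto (fun k => (shr r u 1 u k).2 / (shr r u 0 1 k).2) atTop (nhds X) ∧
    Tendsto (fun k => (shr r u 1 u (k+1)).1 / (shr r u 0 1 (k+1)).1) atTop (nhds X) := by
  have hq := fun k => (shr_pos r u 0 1 hr hu le_rfl one_pos k).2
  have ho : ∀ k, 0 < (shr r u 0 1 (k+1)).1 := fun k =>
    lt_of_lt_of_le (by positivity) (shr_o_ge r u hr hu k)
  have hmono : Monotone (fun k => (shr r u 1 u k).2 / (shr r u 0 1 k).2) := by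
    refine monotone_nat_of_le_succ fun k => ?_
    rw [div_le_div_iff₀ (hq k) (hq _)]
    have := shr_det r u k
    simp only [shr_succ_snd, shr_succ_fst]
    nlinarith
  have hanti : Antitone (fun k => (shr r u 1 u (k+1)).1 / (shr r u 0 1 (k+1)).1) := by
    refine antitone_nat_of_succ_le fun k => ?_
    rw [div_le_div_iff₀ (ho _) (ho _)]
    have := shr_det r u (k+1)
    rw [shr_succ_fst _ _ _ _ (k+1), shr_succ_fst _ _ _ _ (k+1)]
    have hi : 0 < (4 * (((k+1 : ℕ) : ℝ) + 1) ^ 2 * r ^ 2)⁻¹ := by positivity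
    nlinarith
  have hgap : ∀ k, (shr r u 1 u (k+1)).1 / (shr r u 0 1 (k+1)).1 -
      (shr r u 1 u (k+1)).2 / (shr r u 0 1 (k+1)).2 =
      1 / ((shr r u 0 1 (k+1)).1 * (shr r u 0 1 (k+1)).2) := fun k => by
    have := shr_det r u (k+1)
    have h1 := (ho k).ne'
    have h2 := (hq (k+1)).ne'
    field_simp
    linarith
  have hgap0 : Tendsto (fun k => 1 / ((shr r u 0 1 (k+1)).1 * (shr r u 0 1 (k+1)).2)) atTop
      (nhds 0) := by
    have hb : Tendsto (fun k : ℕ => (shr r u 0 1 (k+1)).1 * (shr r u 0 1 (k+1)).2) atTop atTop := by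
      have hc : 0 < (4 * r ^ 2)⁻¹ * (u * (4 * r ^ 2)⁻¹) := by positivity
      refine tendsto_atTop_mono (f := fun k : ℕ => (k : ℝ) * ((4 * r ^ 2)⁻¹ * (u * (4 * r ^ 2)⁻¹)))
        (fun k => ?_) (tendsto_natCast_atTop_atTop.atTop_mul_const hc)
      have h1 := shr_o_ge r u hr hu k
      have h2 := shr_q_ge r u hr hu (k+1)
      have h3 : (k : ℝ) * (u * (4 * r ^ 2)⁻¹) ≤ (shr r u 0 1 (k+1)).2 := by
        refine le_trans ?_ h2
        push_cast
        have : 0 < u * (4 * r ^ 2)⁻¹ := by positivity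
        nlinarith
      calc (k : ℝ) * ((4 * r ^ 2)⁻¹ * (u * (4 * r ^ 2)⁻¹))
          = (4 * r ^ 2)⁻¹ * ((k : ℝ) * (u * (4 * r ^ 2)⁻¹)) := by ring
        _ ≤ _ := mul_le_mul h1 h3 (by positivity) (ho k).le
    simp only [one_div]
    exact hb.inv_tendsto_atTop
  have hbd : BddAbove (Set.range (fun k => (shr r u 1 u k).2 / (shr r u 0 1 k).2)) := by
    refine ⟨(shr r u 1 u (0+1)).1 / (shr r u 0 1 (0+1)).1, ?_⟩
    rintro _ ⟨k, rfl⟩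
    have h1 := hmono (Nat.le_succ k)
    have h2 := hanti (Nat.zero_le k)
    have h3 : 0 < 1 / ((shr r u 0 1 (k+1)).1 * (shr r u 0 1 (k+1)).2) :=
      one_div_pos.2 (mul_pos (ho k) (hq _))
    have h4 := hgap k
    simp only [Nat.succ_eq_add_one] at h1 h2 ⊢
    linarith
  have hT := tendsto_atTop_ciSup hmono hbd
  refine ⟨_, ?_, hT, ?_⟩
  · have := le_ciSup hbd 0
    simpa [shr] using this
  · have h5 := (hT.comp (tendsto_add_atTop_nat 1)).add hgap0
    rw [add_zero] at h5
    refine h5.congr fun k => ?_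
    have := hgap k
    simp only [Function.comp]
    linarith

/-- limit value -/
noncomputable def cfX (r u : ℝ) : ℝ :=
  limUnder atTop (fun k => (shr r u 1 u k).2 / (shr r u 0 1 k).2)

lemma cfX_spec (r u : ℝ) (hr : 0 < r) (hu : 0 < u) : u ≤ cfX r u ∧
    Tendsto (fun k => (shr r u 1 u k).2 / (shr r u 0 1 k).2) atTop (nhds (cfX r u)) ∧
    Tendsto (fun k => (shr r u 1 u (k+1)).1 / (shr r u 0 1 (k+1)).1) atTop (nhds (cfX r u)) := by
  obtain ⟨X, h1, h2, h3⟩ := shr_lim r u hr hu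
  have : cfX r u = X := h2.limUnder_eq
  rw [this]; exact ⟨h1, h2, h3⟩

lemma cfX_rel (r v : ℝ) (hr : 0 < r) (hv : 2 * r < v) :
    1 / cfX r (v ^ 2 - 2 * v * r) + 1 / cfX r (v ^ 2 + 2 * v * r) = 2 / v ^ 2 := by
  have hv0 : 0 < v := by linarith
  obtain ⟨u, hu⟩ : ∃ u, u = v ^ 2 - 2 * v * r := ⟨_, rfl⟩
  obtain ⟨u', hu'⟩ : ∃ u, u = v ^ 2 + 2 * v * r := ⟨_, rfl⟩
  rw [← hu, ← hu']
  have hup : 0 < u := by rw [hu]; nlinarith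
  have hup' : 0 < u' := by rw [hu']; positivity
  obtain ⟨a1, a2, a3⟩ := cfX_spec r u hr hup
  obtain ⟨b1, b2, b3⟩ := cfX_spec r u' hr hup'
  have hq := fun k => (shr_pos r u 0 1 hr hup le_rfl one_pos k).2
  have hq' := fun k => (shr_pos r u' 0 1 hr hup' le_rfl one_pos k).2
  have ho : ∀ k, 0 < (shr r u 0 1 (k+1)).1 := fun k =>
    lt_of_lt_of_le (by positivity) (shr_o_ge r u hr hup k)
  have ho' : ∀ k, 0 < (shr r u' 0 1 (k+1)).1 := fun k =>
    lt_of_lt_of_le (by positivity) (shr_o_ge r u' hr hup' k)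
  have t1 := ((a3.mul b3).const_mul 2).sub ((a3.add b3).const_mul (v^2))
  have t2 := ((a2.mul b2).const_mul 2).sub ((a2.add b2).const_mul (v^2))
  have g1 : 0 ≤ 2 * (cfX r u * cfX r u') - v^2 * (cfX r u + cfX r u') := by
    refine ge_of_tendsto' t1 fun k => ?_
    have h := (shr_form r v u u' hr hu hu' (k+1)).1
    have e : 2 * ((shr r u 1 u (k+1)).1 / (shr r u 0 1 (k+1)).1 *
        ((shr r u' 1 u' (k+1)).1 / (shr r u' 0 1 (k+1)).1)) -
        v^2 * ((shr r u 1 u (k+1)).1 / (shr r u 0 1 (k+1)).1 +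
        (shr r u' 1 u' (k+1)).1 / (shr r u' 0 1 (k+1)).1) =
        2 / ((shr r u 0 1 (k+1)).1 * (shr r u' 0 1 (k+1)).1) := by
      have h1 := (ho k).ne'
      have h2 := (ho' k).ne'
      field_simp
      linear_combination h
    rw [e]
    exact (div_pos two_pos (mul_pos (ho k) (ho' k))).le
  have g2 : 2 * (cfX r u * cfX r u') - v^2 * (cfX r u + cfX r u') ≤ 0 := by
    refine le_of_tendsto' t2 fun k => ?_
    have h := (shr_form r v u u' hr hu hu' (k+1)).2.2.2
    simp only [shr_succ_snd, add_sub_cancel_right] at h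
    have e : 2 * ((shr r u 1 u k).2 / (shr r u 0 1 k).2 *
        ((shr r u' 1 u' k).2 / (shr r u' 0 1 k).2)) -
        v^2 * ((shr r u 1 u k).2 / (shr r u 0 1 k).2 +
        (shr r u' 1 u' k).2 / (shr r u' 0 1 k).2) =
        - (8 * ((k+1 : ℕ) : ℝ)^2 * v^2 * r^2) / ((shr r u 0 1 k).2 * (shr r u' 0 1 k).2) := by
      have h1 := (hq k).ne'
      have h2 := (hq' k).ne'
      field_simp
      linear_combination h
    rw [e]
    exact div_nonpos_of_nonpos_of_nonneg (by rw [neg_nonpos]; positivity)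
      (mul_pos (hq k) (hq' k)).le
  have hX : 0 < cfX r u := by linarith
  have hX' : 0 < cfX r u' := by linarith
  field_simp
  linarith

/-- main CF evaluation -/
lemma cfX_sum (r v : ℝ) (hr : 0 < r) (hv : r < v) :
    Tendsto (fun n => ∑ k ∈ Finset.range n, (-1 : ℝ) ^ k * (2 / (v + r + 2 * r * k) ^ 2)) atTop
      (nhds (1 / cfX r (v ^ 2 - r ^ 2))) := by
  have key : ∀ n : ℕ, ∑ k ∈ Finset.range n, (-1 : ℝ) ^ k * (2 / (v + r + 2 * r * k) ^ 2) =
      1 / cfX r (v ^ 2 - r ^ 2) - (-1) ^ n * (1 / cfX r ((v + 2 * r * n) ^ 2 - r ^ 2)) := by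
    intro n
    induction n with
    | zero => simp
    | succ n ih =>
      rw [Finset.sum_range_succ, ih]
      have hn : (0 : ℝ) ≤ 2 * r * n := by positivity
      have := cfX_rel r (v + r + 2 * r * n) hr (by linarith)
      have e1 : (v + r + 2 * r * n) ^ 2 - 2 * (v + r + 2 * r * n) * r = (v + 2 * r * n) ^ 2 - r ^ 2 := by
        ring
      have e2 : (v + r + 2 * r * n) ^ 2 + 2 * (v + r + 2 * r * n) * r =
        (v + 2 * r * (n + 1 : ℕ)) ^ 2 - r ^ 2 := by push_cast; ring
      rw [e1, e2] at this
      rw [← this, pow_succ]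
      ring
  have h0 : Tendsto (fun n : ℕ => (-1 : ℝ) ^ n * (1 / cfX r ((v + 2 * r * n) ^ 2 - r ^ 2))) atTop
      (nhds 0) := by
    have hb : Tendsto (fun n : ℕ => (n : ℝ) * (4 * r * (v - r))) atTop atTop :=
      tendsto_natCast_atTop_atTop.atTop_mul_const (by nlinarith)
    have hX : Tendsto (fun n : ℕ => cfX r ((v + 2 * r * n) ^ 2 - r ^ 2)) atTop atTop := by
      refine tendsto_atTop_mono (fun n => ?_) hb
      have hn : (0 : ℝ) ≤ n := by positivity
      have h2 : 0 ≤ r * n := by positivity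
      have h1 : (n : ℝ) * (4 * r * (v - r)) ≤ (v + 2 * r * n) ^ 2 - r ^ 2 := by nlinarith
      exact h1.trans (cfX_spec r _ hr (by nlinarith)).1
    refine squeeze_zero_norm (a := fun n : ℕ => |(cfX r ((v + 2 * r * n) ^ 2 - r ^ 2))⁻¹|) (fun n => ?_) ?_
    · simp
    · simpa using hX.inv_tendsto_atTop.abs
  have := (tendsto_const_nhds (x := 1 / cfX r (v ^ 2 - r ^ 2)) (f := (atTop : Filter ℕ))).sub h0
  rw [sub_zero] at this
  exact this.congr fun n => (key n).symm

lemma cf_link (r u : ℝ) (hr : 0 < r) (k : ℕ) : ∃ P : ℝ, 0 < P ∧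
    cfNum 0 (fun n => 4 * ((((n + 1) / 2 : ℕ)) : ℝ) ^ 2 * r ^ 2)
      (fun n => if n % 2 = 1 then 1 else u) (2 * k) =
      P * ((shr r u 1 u k).2 - u * (shr r u 0 1 k).2) ∧
    cfDen (fun n => 4 * ((((n + 1) / 2 : ℕ)) : ℝ) ^ 2 * r ^ 2)
      (fun n => if n % 2 = 1 then 1 else u) (2 * k) = P * (shr r u 0 1 k).2 ∧
    cfNum 0 (fun n => 4 * ((((n + 1) / 2 : ℕ)) : ℝ) ^ 2 * r ^ 2)
      (fun n => if n % 2 = 1 then 1 else u) (2 * k + 1) =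
      P * (4 * ((k : ℝ) + 1) ^ 2 * r ^ 2) *
        ((shr r u 1 u (k+1)).1 - u * (shr r u 0 1 (k+1)).1) ∧
    cfDen (fun n => 4 * ((((n + 1) / 2 : ℕ)) : ℝ) ^ 2 * r ^ 2)
      (fun n => if n % 2 = 1 then 1 else u) (2 * k + 1) =
      P * (4 * ((k : ℝ) + 1) ^ 2 * r ^ 2) * (shr r u 0 1 (k+1)).1 := by
  induction k with
  | zero =>
    refine ⟨1, one_pos, ?_⟩
    have : r ≠ 0 := hr.ne'
    simp [cfNum, cfDen, shr]
    field_simp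
  | succ k ih =>
    obtain ⟨P, hP, h1, h2, h3, h4⟩ := ih
    refine ⟨P * (4 * ((k : ℝ) + 1) ^ 2 * r ^ 2), by positivity, ?_⟩
    have hi : (4 * (((k + 1 : ℕ) : ℝ) + 1) ^ 2 * r ^ 2)⁻¹ * (4 * (((k + 1 : ℕ) : ℝ) + 1) ^ 2 * r ^ 2) = 1 :=
      inv_mul_cancel₀ (by positivity)
    have m0 : (2 * k + 2) % 2 = 0 := by omega
    have m1 : (2 * k + 1 + 2) % 2 = 1 := by omega
    have d0 : (2 * k + 2 + 1) / 2 = k + 1 := by omega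
    have d1 : (2 * k + 1 + 2 + 1) / 2 = k + 1 + 1 := by omega
    have n0 := show 2 * (k + 1) = 2 * k + 2 by ring
    have n1 := show 2 * k + 2 + 1 = 2 * k + 1 + 2 by ring
    rw [n0]
    have e1 : cfNum 0 (fun n => 4 * ((((n + 1) / 2 : ℕ)) : ℝ) ^ 2 * r ^ 2)
      (fun n => if n % 2 = 1 then 1 else u) (2 * k + 2) = P * (4 * ((k : ℝ) + 1) ^ 2 * r ^ 2) *
        ((shr r u 1 u (k+1)).2 - u * (shr r u 0 1 (k+1)).2) := by
      rw [cfNum, h1, h3, shr_succ_snd, shr_succ_snd]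
      simp only [m0, d0]
      push_cast
      ring
    have e2 : cfDen (fun n => 4 * ((((n + 1) / 2 : ℕ)) : ℝ) ^ 2 * r ^ 2)
      (fun n => if n % 2 = 1 then 1 else u) (2 * k + 2) = P * (4 * ((k : ℝ) + 1) ^ 2 * r ^ 2) *
        (shr r u 0 1 (k+1)).2 := by
      rw [cfDen, h2, h4, shr_succ_snd]
      simp only [m0, d0]
      push_cast
      ring
    refine ⟨e1, e2, ?_, ?_⟩
    · rw [n1, cfNum, h3, show 2 * k + 1 + 1 = 2 * k + 2 by rfl, e1, shr_succ_fst _ _ _ _ (k+1),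
        shr_succ_fst _ _ _ _ (k+1)]
      simp only [m1, d1, if_true]
      push_cast at hi ⊢
      linear_combination (-P * (4 * ((k : ℝ) + 1) ^ 2 * r ^ 2) *
        ((shr r u 1 u (k+1)).2 - u * (shr r u 0 1 (k+1)).2)) * hi
    · rw [n1, cfDen, h4, show 2 * k + 1 + 1 = 2 * k + 2 by rfl, e2, shr_succ_fst _ _ _ _ (k+1)]
      simp only [m1, d1, if_true]
      push_cast at hi ⊢
      linear_combination (-P * (4 * ((k : ℝ) + 1) ^ 2 * r ^ 2) *
        ((shr r u 0 1 (k+1)).2)) * hi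

lemma cf_limit (r u L : ℝ) (hr : 0 < r) (hu : 0 < u)
    (hL : IsCFLimit 0 (fun n => 4 * ((((n + 1) / 2 : ℕ)) : ℝ) ^ 2 * r ^ 2)
      (fun n => if n % 2 = 1 then 1 else u) L) : u + L = cfX r u := by
  have h1 := Filter.Tendsto.comp hL (tendsto_id.const_mul_atTop' (show 0 < 2 by norm_num))
  have h2 := (cfX_spec r u hr hu).2.1.sub_const u
  have := tendsto_nhds_unique (h2.congr fun k => ?_) h1
  · linarith
  · obtain ⟨P, hP, h1, h2, -, -⟩ := cf_link r u hr k
    have hq := (shr_pos r u 0 1 hr hu le_rfl one_pos k).2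
    simp only [Function.comp, id]
    rw [h1, h2]
    field_simp

lemma logGamma_seq (x : ℝ) (N : ℕ) :
    ∑ n ∈ Finset.range N, (x * (Real.log (n + 2) - Real.log (n + 1)) - Real.log (x + (n + 1))
      + Real.log (n + 1)) =
    Real.BohrMollerup.logGammaSeq x N + Real.log x + x * (Real.log (N + 1) - Real.log N) := by
  have h : ∑ n ∈ Finset.range N, (x * (Real.log (n + 2) - Real.log (n + 1)) - Real.log (x + (n + 1))
      + Real.log (n + 1)) = x * Real.log (N + 1) + Real.log (N.factorial)
        - ∑ m ∈ Finset.range (N + 1), Real.log (x + m) + Real.log x := by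
    induction N with
    | zero => simp
    | succ N ih =>
      rw [Finset.sum_range_succ, ih, Finset.sum_range_succ _ (N+1), Nat.factorial_succ]
      push_cast
      rw [Real.log_mul (by positivity) (by positivity), show (N : ℝ) + 1 + 1 = N + 2 by ring]
      ring
  rw [h, Real.BohrMollerup.logGammaSeq]
  ring

lemma log_diff_bd (n : ℕ) : 1 / ((n : ℝ) + 2) ≤ Real.log (n + 2) - Real.log (n + 1) ∧
    Real.log (n + 2) - Real.log (n + 1) ≤ 1 / ((n : ℝ) + 1) := by
  have hn : (0 : ℝ) ≤ n := by positivity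
  rw [← Real.log_div (by positivity) (by positivity)]
  have hp : 0 < ((n : ℝ) + 2) / (n + 1) := by positivity
  have h1 := Real.log_le_sub_one_of_pos hp
  have h2 := Real.one_sub_inv_le_log_of_pos hp
  have e1 : ((n : ℝ) + 2) / (n + 1) - 1 = 1 / ((n : ℝ) + 1) := by field_simp; ring
  have e2 : 1 - (((n : ℝ) + 2) / (n + 1))⁻¹ = 1 / ((n : ℝ) + 2) := by field_simp; ring
  rw [e1] at h1
  rw [e2] at h2
  exact ⟨h2, h1⟩

lemma summ_sq : Summable (fun n : ℕ => 1 / ((n : ℝ) + 1) ^ 2) := by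
  have := (summable_nat_add_iff 1).2 (Real.summable_one_div_nat_pow.2 (show 1 < 2 by norm_num))
  simpa using this

lemma gterm_deriv (n : ℕ) (y : ℝ) (hy : 0 < y) :
    HasDerivAt (fun x => x * (Real.log (n + 2) - Real.log (n + 1)) - Real.log (x + (n + 1))
      + Real.log (n + 1)) (Real.log (n + 2) - Real.log (n + 1) - 1 / (y + (n + 1))) y := by
  have h1 : HasDerivAt (fun x => x * (Real.log (n + 2) - Real.log (n + 1)))
    (Real.log (n + 2) - Real.log (n + 1)) y := by
    simpa using (hasDerivAt_id y).mul_const (Real.log ((n:ℝ) + 2) - Real.log (n + 1))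
  have h2 := ((hasDerivAt_id y).add_const ((n : ℝ) + 1)).log (by simp; positivity)
  exact (h1.sub h2).add_const _

lemma gterm_bd (M : ℝ) (n : ℕ) (y : ℝ) (hy : 0 < y) (hM : y < M) :
    ‖Real.log (n + 2) - Real.log (n + 1) - 1 / (y + (n + 1))‖ ≤ (M + 1) * (1 / ((n : ℝ) + 1) ^ 2) := by
  obtain ⟨h1, h2⟩ := log_diff_bd n
  have hn : (0 : ℝ) < (n : ℝ) + 1 := by positivity
  have a1 : 1 / (y + (n + 1)) ≤ 1 / ((n : ℝ) + 1) := by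
    apply one_div_le_one_div_of_le hn; linarith
  have a2 : 1 / ((n : ℝ) + 1) - 1 / (y + (n + 1)) ≤ (M + 1) * (1 / ((n : ℝ) + 1) ^ 2) := by
    rw [div_sub_div _ _ hn.ne' (by positivity), ← div_eq_mul_one_div, div_le_div_iff₀ (by positivity) (by positivity)]
    have hM0 : 0 < M := by linarith
    have e : (1 * (y + ((n : ℝ) + 1)) - (n + 1) * 1) = y := by ring
    rw [e]
    have := mul_le_mul_of_nonneg_right hM.le (sq_nonneg ((n:ℝ)+1))
    nlinarith [mul_pos hy hn, mul_pos hM0 (mul_pos hy hn), sq_nonneg ((n:ℝ)+1)]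
  have a3 : 1 / ((n : ℝ) + 1) - 1 / ((n : ℝ) + 2) ≤ (M + 1) * (1 / ((n : ℝ) + 1) ^ 2) := by
    have : 1 / ((n : ℝ) + 1) - 1 / ((n : ℝ) + 2) ≤ 1 / ((n : ℝ) + 1) ^ 2 := by
      rw [div_sub_div _ _ hn.ne' (by positivity), div_le_div_iff₀ (by positivity) (by positivity)]
      nlinarith
    have h3 : 0 < 1 / ((n : ℝ) + 1) ^ 2 := by positivity
    nlinarith
  rw [Real.norm_eq_abs, abs_le]
  constructor <;> linarith

/-- digamma as a series -/
noncomputable def psi0 (x : ℝ) : ℝ :=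
  ∑' n : ℕ, (Real.log (n + 2) - Real.log (n + 1) - 1 / (x + (n + 1))) - 1 / x

noncomputable def psi1 (x : ℝ) : ℝ := ∑' n : ℕ, 1 / (x + n) ^ 2

lemma summ_psi1 (x : ℝ) (hx : 0 < x) : Summable (fun n : ℕ => 1 / (x + n) ^ 2) := by
  rw [← summable_nat_add_iff 1]
  refine Summable.of_nonneg_of_le (fun n => by positivity) (fun n => ?_) summ_sq
  push_cast
  apply one_div_le_one_div_of_le (by positivity)
  exact pow_le_pow_left₀ (by positivity) (by linarith) 2

lemma logGamma_eq (x : ℝ) (hx : 0 < x) : Real.log (Real.Gamma x) =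
    ∑' n : ℕ, (x * (Real.log (n + 2) - Real.log (n + 1)) - Real.log (x + (n + 1))
      + Real.log (n + 1)) - Real.log x := by
  have hs : Summable (fun n : ℕ => x * (Real.log (n + 2) - Real.log (n + 1)) - Real.log (x + (n + 1))
      + Real.log (n + 1)) := by
    refine summable_of_summable_hasDerivAt_of_isPreconnected
      (summ_sq.mul_left (x + 1 + 1 + 1)) (t := Set.Ioo 0 (x + 1 + 1)) isOpen_Ioo isPreconnected_Ioo
      (g := fun (n : ℕ) x => x * (Real.log (n + 2) - Real.log (n + 1)) - Real.log (x + (n + 1))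
      + Real.log (n + 1))
      (fun n y hy => gterm_deriv n y hy.1) (fun n y hy => gterm_bd _ n y hy.1 hy.2) (y₀ := 1)
      ⟨one_pos, by linarith⟩ ?_ ⟨hx, by linarith⟩
    convert summable_zero with n
    rw [show (1 : ℝ) + (n + 1) = n + 2 by ring]; ring
  have h1 := hs.hasSum.tendsto_sum_nat
  simp only [logGamma_seq] at h1
  have h2 := Real.BohrMollerup.tendsto_log_gamma hx
  have h3 : Tendsto (fun N : ℕ => Real.log ((N : ℝ) + 1) - Real.log N) atTop (nhds 0) :=
    Real.tendsto_log_nat_add_one_sub_log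
  have h4 := (h2.add_const (Real.log x)).add (h3.const_mul x)
  have := tendsto_nhds_unique h1 h4
  linarith

lemma logGamma_deriv (x : ℝ) (hx : 0 < x) :
    HasDerivAt (fun t => Real.log (Real.Gamma t)) (psi0 x) x := by
  have h := hasDerivAt_tsum_of_isPreconnected
      (summ_sq.mul_left (x + 1 + 1 + 1)) (t := Set.Ioo 0 (x + 1 + 1)) isOpen_Ioo isPreconnected_Ioo
      (g := fun (n : ℕ) x => x * (Real.log (n + 2) - Real.log (n + 1)) - Real.log (x + (n + 1))
      + Real.log (n + 1))
      (fun n y hy => gterm_deriv n y hy.1) (fun n y hy => gterm_bd _ n y hy.1 hy.2) (y₀ := 1)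
      ⟨one_pos, by linarith⟩ (by
        convert summable_zero with n
        rw [show (1 : ℝ) + (n + 1) = n + 2 by ring]; ring) (y := x) ⟨hx, by linarith⟩
  have h2 := h.sub (Real.hasDerivAt_log hx.ne')
  rw [inv_eq_one_div] at h2
  refine h2.congr_of_eventuallyEq ?_
  filter_upwards [lt_mem_nhds hx] with t ht
  exact logGamma_eq t ht

lemma psi0_deriv (x : ℝ) (hx : 0 < x) : HasDerivAt psi0 (psi1 x) x := by
  have h := hasDerivAt_tsum_of_isPreconnected
      summ_sq (t := Set.Ioi 0) isOpen_Ioi isPreconnected_Ioi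
      (g := fun (n : ℕ) x => Real.log (n + 2) - Real.log (n + 1) - 1 / (x + (n + 1)))
      (g' := fun (n : ℕ) x => 1 / (x + (n + 1)) ^ 2)
      (fun n y hy => by
        have hy' : 0 < y := hy
        have h2 := ((hasDerivAt_id y).add_const ((n : ℝ) + 1)).inv (by simp; positivity)
        have h3 := h2.const_sub (Real.log (n + 2) - Real.log (n + 1))
        simp only [one_div]
        convert! h3 using 1
        simp [neg_div]) (fun n y hy => by
        have hy' : 0 < y := hy
        rw [Real.norm_of_nonneg (by positivity)]
        apply one_div_le_one_div_of_le (by positivity)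
        exact pow_le_pow_left₀ (by positivity) (by linarith) 2) (y₀ := 1) (Set.mem_Ioi.2 one_pos) (by
        refine Summable.of_norm_bounded (summ_sq.mul_left (2 + 1)) fun n => ?_
        exact gterm_bd 2 n 1 one_pos (by norm_num)) (y := x) hx
  have h2 := h.sub (hasDerivAt_inv hx.ne')
  have e : psi1 x = ∑' n : ℕ, 1 / (x + (n + 1)) ^ 2 - -(x ^ 2)⁻¹ := by
    rw [psi1, (summ_psi1 x hx).tsum_eq_zero_add]
    push_cast
    simp
    ring
  rw [e]
  refine h2.congr_of_eventuallyEq ?_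
  filter_upwards with t
  simp [psi0]

lemma alt_sum (r c : ℝ) (hr : 0 < r) (hc : 0 < c) :
    HasSum (fun k : ℕ => (-1 : ℝ) ^ k * (1 / (c + 2 * r * k) ^ 2))
      (1 / (16 * r ^ 2) * (psi1 (c / (4 * r)) - psi1 (c / (4 * r) + 1 / 2))) := by
  have h1 := (summ_psi1 (c / (4 * r)) (by positivity)).hasSum.mul_left (1 / (16 * r ^ 2))
  have h2 := (summ_psi1 (c / (4 * r) + 1 / 2) (by positivity)).hasSum.mul_left (-(1 / (16 * r ^ 2)))
  have h3 : HasSum (fun k : ℕ => (-1 : ℝ) ^ (2 * k) * (1 / (c + 2 * r * ((2 * k : ℕ) : ℝ)) ^ 2))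
      (1 / (16 * r ^ 2) * psi1 (c / (4 * r))) := by
    convert! h1 using 2 with k
    have e : c + 2 * r * ((2 * k : ℕ) : ℝ) = 4 * r * (c / (4 * r) + k) := by
      push_cast; field_simp; ring
    rw [pow_mul, neg_one_sq, one_pow, e, mul_pow, one_mul, ← one_div_mul_one_div]
    ring
  have h4 : HasSum (fun k : ℕ => (-1 : ℝ) ^ (2 * k + 1) *
      (1 / (c + 2 * r * ((2 * k + 1 : ℕ) : ℝ)) ^ 2))
      (-(1 / (16 * r ^ 2)) * psi1 (c / (4 * r) + 1 / 2)) := by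
    convert! h2 using 2 with k
    have e : c + 2 * r * ((2 * k + 1 : ℕ) : ℝ) = 4 * r * (c / (4 * r) + 1 / 2 + k) := by
      push_cast; field_simp; ring
    rw [pow_succ, pow_mul, neg_one_sq, one_pow, e, mul_pow, one_mul, ← one_div_mul_one_div]
    ring
  have := HasSum.even_add_odd (f := fun k : ℕ => (-1 : ℝ) ^ k * (1 / (c + 2 * r * k) ^ 2)) h3 h4
  convert! this using 1
  ring

lemma xexp (b : ℝ) (hb : 0 < b) :
    MeasureTheory.IntegrableOn (fun x : ℝ => x * Real.exp (-b * x)) (Set.Ioi 0) ∧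
    ∫ x in Set.Ioi (0 : ℝ), x * Real.exp (-b * x) = 1 / b ^ 2 := by
  constructor
  · have := integrableOn_rpow_mul_exp_neg_mul_rpow (p := 1) (s := 1) (by norm_num) one_pos hb
    simpa using this
  · have := Real.integral_rpow_mul_exp_neg_mul_Ioi (a := 2) two_pos hb
    rw [show (2 : ℝ) - 1 = 1 by norm_num] at this
    simpa [Real.Gamma_two] using this

lemma integral_cosh (a b : ℝ) (ha : 0 < a) (hb : 0 < b) :
    HasSum (fun k : ℕ => (-1 : ℝ) ^ k * (2 * (1 / (a + 1 + 2 * k) ^ 2 + 1 / (b + 1 + 2 * k) ^ 2)))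
      (∫ x in Set.Ioi (0 : ℝ), x * (Real.exp (-a * x) + Real.exp (-b * x)) / Real.cosh x) := by
  have hpos : ∀ a : ℝ, 0 < a → ∀ k : ℕ, 0 < a + 1 + 2 * k := fun a ha k => by positivity
  let G : ℕ → ℝ → ℝ := fun k x => 2 * (x * Real.exp (-(a + 1 + 2 * k) * x) +
    x * Real.exp (-(b + 1 + 2 * k) * x))
  have hGi : ∀ k, MeasureTheory.IntegrableOn (G k) (Set.Ioi 0) := fun k =>
    ((xexp _ (hpos a ha k)).1.add (xexp _ (hpos b hb k)).1).const_mul 2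
  have hGv : ∀ k, ∫ x in Set.Ioi (0 : ℝ), G k x =
      2 * (1 / (a + 1 + 2 * k) ^ 2 + 1 / (b + 1 + 2 * k) ^ 2) := fun k => by
    simp only [G]
    rw [MeasureTheory.integral_const_mul, MeasureTheory.integral_add (xexp _ (hpos a ha k)).1
      (xexp _ (hpos b hb k)).1, (xexp _ (hpos a ha k)).2, (xexp _ (hpos b hb k)).2]
  have hsum : ∀ a : ℝ, 0 < a → Summable (fun k : ℕ => 1 / (a + 1 + 2 * (k : ℝ)) ^ 2) := fun a ha => by
    refine Summable.of_nonneg_of_le (fun n => by positivity) (fun n => ?_) summ_sq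
    apply one_div_le_one_div_of_le (by positivity)
    have hn : (0 : ℝ) ≤ n := by positivity
    exact pow_le_pow_left₀ (by positivity) (by linarith) 2
  have key := MeasureTheory.hasSum_integral_of_summable_integral_norm
    (μ := MeasureTheory.volume.restrict (Set.Ioi (0 : ℝ))) (F := fun k x => (-1 : ℝ) ^ k * G k x)
    (fun k => (hGi k).const_mul _) (by
      refine (((hsum a ha).add (hsum b hb)).mul_left 2).congr fun k => ?_
      rw [← hGv k]
      refine MeasureTheory.setIntegral_congr_fun measurableSet_Ioi fun x hx => ?_
      have hx' : 0 < x := hx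
      have : 0 ≤ G k x := by simp only [G]; positivity
      simp [abs_of_nonneg this])
  simp only [MeasureTheory.integral_const_mul, hGv] at key
  convert! key using 1
  refine MeasureTheory.setIntegral_congr_fun measurableSet_Ioi fun x hx => ?_
  have hx' : 0 < x := hx
  have hg : HasSum (fun k : ℕ => (-Real.exp (-2 * x)) ^ k) (1 - -Real.exp (-2 * x))⁻¹ := by
    apply hasSum_geometric_of_norm_lt_one
    rw [norm_neg, Real.norm_of_nonneg (Real.exp_pos _).le, Real.exp_lt_one_iff]
    linarith
  have h2 := hg.mul_left (2 * x * (Real.exp (-(a + 1) * x) + Real.exp (-(b + 1) * x)))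
  have h3 : (fun k : ℕ => (-1 : ℝ) ^ k * G k x) = fun k : ℕ =>
      2 * x * (Real.exp (-(a + 1) * x) + Real.exp (-(b + 1) * x)) * (-Real.exp (-2 * x)) ^ k := by
    funext k
    have e : ∀ a : ℝ, Real.exp (-(a + 1 + 2 * k) * x) =
        Real.exp (-(a + 1) * x) * Real.exp (-2 * x) ^ k := fun a => by
      rw [← Real.exp_nat_mul, ← Real.exp_add]
      congr 1
      ring
    simp only [G]
    rw [e, e, neg_pow (Real.exp (-2 * x))]
    ring
  simp only [h3]
  rw [h2.tsum_eq, Real.cosh_eq]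
  have e1 : ∀ a : ℝ, Real.exp (-(a + 1) * x) = Real.exp (-a * x) * Real.exp (-x) := fun a => by
    rw [← Real.exp_add]; congr 1; ring
  have e2 : Real.exp (-2 * x) = Real.exp (-x) * Real.exp (-x) := by
    rw [← Real.exp_add]; congr 1; ring
  have e3 : Real.exp x = (Real.exp (-x))⁻¹ := by rw [Real.exp_neg, inv_inv]
  have hE := Real.exp_pos (-x)
  rw [e1, e1, e2, e3]
  generalize Real.exp (-x) = E at *
  have h4 : (1 - -(E * E)) = 1 + E ^ 2 := by ring
  have h5 : E⁻¹ + E = (1 + E ^ 2) / E := by field_simp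
  have h6 : 1 + E ^ 2 ≠ 0 := by positivity
  rw [h4, h5]
  field_simp

lemma logy_deriv2 (r s : ℝ) (hr : 1 / 2 < r) (hs : 0 < s) :
    deriv (deriv (fun t : ℝ => Real.log (yGen r t))) s =
      - (1 / (16 * r ^ 2) * (psi1 ((s + 1) / (4 * r)) - psi1 ((s + 1) / (4 * r) + 1 / 2)))
      - (1 / (16 * r ^ 2) * (psi1 ((s + 2 * r - 1) / (4 * r))
        - psi1 ((s + 2 * r - 1) / (4 * r) + 1 / 2))) := by
  have hr0 : 0 < r := by linarith
  have hlin : ∀ c t : ℝ, HasDerivAt (fun t : ℝ => (t + c) / (4 * r)) (1 / (4 * r)) t := fun c t =>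
    ((hasDerivAt_id t).add_const c).div_const _
  have hpos : ∀ c t : ℝ, 0 < t → 0 ≤ c → 0 < (t + c) / (4 * r) := fun c t ht hc => by positivity
  have hlog : ∀ t : ℝ, 0 < t → Real.log (yGen r t) = Real.log (4 * r)
      + (Real.log (Real.Gamma ((t + (2 * r + 1)) / (4 * r)))
      + Real.log (Real.Gamma ((t + (4 * r - 1)) / (4 * r))))
      - (Real.log (Real.Gamma ((t + 1) / (4 * r)))
      + Real.log (Real.Gamma ((t + (2 * r - 1)) / (4 * r)))) := fun t ht => by
    have g1 := Real.Gamma_pos_of_pos (hpos (2 * r + 1) t ht (by linarith))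
    have g2 := Real.Gamma_pos_of_pos (hpos (4 * r - 1) t ht (by linarith))
    have g3 := Real.Gamma_pos_of_pos (hpos 1 t ht (by linarith))
    have g4 := Real.Gamma_pos_of_pos (hpos (2 * r - 1) t ht (by linarith))
    rw [yGen, show t + 2 * r + 1 = t + (2 * r + 1) by ring,
      show t + 4 * r - 1 = t + (4 * r - 1) by ring, show t + 2 * r - 1 = t + (2 * r - 1) by ring,
      Real.log_div (by positivity) (by positivity), Real.log_mul (by positivity) (by positivity),
      Real.log_mul g1.ne' g2.ne', Real.log_mul g3.ne' g4.ne']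
  have hd : ∀ t : ℝ, 0 < t → deriv (fun t : ℝ => Real.log (yGen r t)) t =
      (psi0 ((t + (2 * r + 1)) / (4 * r)) * (1 / (4 * r)) +
        psi0 ((t + (4 * r - 1)) / (4 * r)) * (1 / (4 * r))) -
      (psi0 ((t + 1) / (4 * r)) * (1 / (4 * r)) +
        psi0 ((t + (2 * r - 1)) / (4 * r)) * (1 / (4 * r))) := fun t ht => by
    have hc : ∀ c : ℝ, 0 ≤ c → HasDerivAt (fun t => Real.log (Real.Gamma ((t + c) / (4 * r))))
        (psi0 ((t + c) / (4 * r)) * (1 / (4 * r))) t := fun c hc =>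
      HasDerivAt.comp (h₂ := fun t => Real.log (Real.Gamma t)) t (logGamma_deriv _ (hpos c t ht hc)) (hlin c t)
    have h := (((hc (2 * r + 1) (by linarith)).add (hc (4 * r - 1) (by linarith))).const_add
      (Real.log (4 * r))).sub ((hc 1 (by linarith)).add (hc (2 * r - 1) (by linarith)))
    refine (h.congr_of_eventuallyEq ?_).deriv
    filter_upwards [lt_mem_nhds ht] with t ht
    exact hlog t ht
  have hc : ∀ c : ℝ, 0 ≤ c → HasDerivAt (fun t => psi0 ((t + c) / (4 * r)) * (1 / (4 * r)))
        (psi1 ((s + c) / (4 * r)) * (1 / (4 * r)) * (1 / (4 * r))) s := fun c hc =>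
      ((psi0_deriv _ (hpos c s hs hc)).comp s (hlin c s)).mul_const _
  have h := ((hc (2 * r + 1) (by linarith)).add (hc (4 * r - 1) (by linarith))).sub
    ((hc 1 (by linarith)).add (hc (2 * r - 1) (by linarith)))
  have h2 := (h.congr_of_eventuallyEq (f₁ := deriv (fun t : ℝ => Real.log (yGen r t))) (by
    filter_upwards [lt_mem_nhds hs] with t ht
    exact hd t ht)).deriv
  rw [h2, show (s + (2 * r + 1)) / (4 * r) = (s + 1) / (4 * r) + 1 / 2 by field_simp; ring,
    show (s + (4 * r - 1)) / (4 * r) = (s + 2 * r - 1) / (4 * r) + 1 / 2 by field_simp; ring,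
    show s + (2 * r - 1) = s + 2 * r - 1 by ring]
  field_simp
  ring

lemma cf_value (r v L c u : ℝ) (hr : 0 < r) (hv : r < v) (hu : u = v ^ 2 - r ^ 2) (hc : c = v + r)
    (hL : IsCFLimit 0 (fun n => 4 * ((((n + 1) / 2 : ℕ)) : ℝ) ^ 2 * r ^ 2)
      (fun n => if n % 2 = 1 then 1 else u) L) :
    1 / (2 * u + 2 * L) =
      1 / (16 * r ^ 2) * (psi1 (c / (4 * r)) - psi1 (c / (4 * r) + 1 / 2)) := by
  have hu0 : 0 < u := by rw [hu]; nlinarith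
  have h1 := (cfX_sum r v hr hv).const_mul (1 / 2)
  have h2 := (alt_sum r c hr (by linarith)).tendsto_sum_nat
  have h3 := cf_limit r u L hr hu0 hL
  rw [← hu, ← h3] at h1
  have := tendsto_nhds_unique h1 (h2.congr fun n => ?_)
  · rw [← this, ← mul_add, one_div_mul_one_div]
  · rw [Finset.mul_sum]
    refine Finset.sum_congr rfl fun k _ => ?_
    rw [hc]
    ring

theorem generalized_ramanujan_second_log_deriv (r : ℝ) (hr : 1 / 2 < r)
    (s : ℝ) (hs : max 1 (2*r - 1) < s) (L₁ L₂ : ℝ)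
    (hL₁ : IsCFLimit 0
      (fun n => 4 * ((((n + 1) / 2 : ℕ)) : ℝ) ^ 2 * r ^ 2)
      (fun n => if n % 2 = 1 then 1 else (1 - 2*r + s) * (1 + s)) L₁)
    (hL₂ : IsCFLimit 0
      (fun n => 4 * ((((n + 1) / 2 : ℕ)) : ℝ) ^ 2 * r ^ 2)
      (fun n => if n % 2 = 1 then 1 else (2*r - 1 + s) * (s - 1)) L₂) :
    deriv (deriv (fun t : ℝ => Real.log (yGen r t))) s =
      -(1 / (2 * r ^ 2)) * ∫ x in Set.Ioi (0 : ℝ),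
        x * (Real.exp (-((1 - r + s) / r) * x) + Real.exp (-((r - 1 + s) / r) * x)) /
          Real.cosh x ∧
    deriv (deriv (fun t : ℝ => Real.log (yGen r t))) s =
      -(1 / (2 * ((1 - 2*r + s) * (1 + s)) + 2 * L₁)) -
        1 / (2 * ((2*r - 1 + s) * (s - 1)) + 2 * L₂) := by
  have hr0 : 0 < r := by linarith
  have hs1 : 1 < s := lt_of_le_of_lt (le_max_left _ _) hs
  have hs2 : 2 * r - 1 < s := lt_of_le_of_lt (le_max_right _ _) hs
  have hD := logy_deriv2 r s hr (by linarith)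
  constructor
  · rw [hD]
    have hi := integral_cosh ((1 - r + s) / r) ((r - 1 + s) / r)
      (div_pos (by linarith) hr0) (div_pos (by linarith) hr0)
    have h1 := (alt_sum r (s + 1) hr0 (by linarith)).add
      (alt_sum r (s + 2 * r - 1) hr0 (by linarith))
    have h2 := hi.mul_left (1 / (2 * r ^ 2))
    have e : ∀ k : ℕ, (-1 : ℝ) ^ k * (1 / (s + 1 + 2 * r * k) ^ 2) +
        (-1 : ℝ) ^ k * (1 / (s + 2 * r - 1 + 2 * r * k) ^ 2) = 1 / (2 * r ^ 2) *
        ((-1 : ℝ) ^ k * (2 * (1 / ((1 - r + s) / r + 1 + 2 * k) ^ 2 +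
          1 / ((r - 1 + s) / r + 1 + 2 * k) ^ 2))) := fun k => by
      have e1 : (1 - r + s) / r + 1 + 2 * k = (s + 1 + 2 * r * k) / r := by field_simp; ring
      have e2 : (r - 1 + s) / r + 1 + 2 * k = (s + 2 * r - 1 + 2 * r * k) / r := by
        field_simp; ring
      rw [e1, e2, div_pow, div_pow, one_div_div, one_div_div]
      field_simp
    simp only [e] at h1
    have h3 := h1.unique h2
    linarith
  · rw [hD, cf_value r (1 - r + s) L₁ (s + 1) _ hr0 (by linarith) (by ring) (by ring) hL₁,
      cf_value r (r - 1 + s) L₂ (s + 2 * r - 1) _ hr0 (by linarith) (by ring) (by ring) hL₂]
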